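/- arXiv:2405.15147 — 2 statements merged into one kernel-verified Lean document; each statement's English description precedes it below -/
import Mathlib

section
/- Let n ≥ 3 and let x and b be two permutations in S_n of the same parity (both even or both odd). Then b is adjacent to x in the godan graph EA_n if and only if b∘(12) is adjacent to x∘(12) in EA_n. Consequently, if the neighbours of x of the same parity as x are b₁,…,b_{n−1}, then the neighbours of x∘(12) of the same parity as x∘(12) are exactly b₁∘(12),…,b_{n−1}∘(12). -/
namespace Godan

/-- The transposition (12), using 0-based indices 0,1 for symbols 1,2. -/
def perm12 (n : ℕ) (hn : 3 ≤ n) : Equiv.Perm (Fin n) :=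
  Equiv.swap ⟨0, by omega⟩ ⟨1, by omega⟩

/-- The 3-cycle (123): symbol 1 ↦ 2 ↦ 3 ↦ 1, i.e. index 0 ↦ 1 ↦ 2 ↦ 0. -/
def perm123 (n : ℕ) (hn : 3 ≤ n) : Equiv.Perm (Fin n) :=
  Equiv.swap ⟨0, by omega⟩ ⟨2, by omega⟩ * Equiv.swap ⟨0, by omega⟩ ⟨1, by omega⟩

/-- The 3-cycle (132): symbol 1 ↦ 3 ↦ 2 ↦ 1, i.e. index 0 ↦ 2 ↦ 1 ↦ 0. -/
def perm132 (n : ℕ) (hn : 3 ≤ n) : Equiv.Perm (Fin n) :=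
  Equiv.swap ⟨0, by omega⟩ ⟨1, by omega⟩ * Equiv.swap ⟨0, by omega⟩ ⟨2, by omega⟩

/-- Ω* = {(12), (123), (132)} ∪ {(12)(3i) : 4 ≤ i ≤ n}; symbol i has index i - 1,
so the transposition (3i) is `Equiv.swap ⟨2,_⟩ k` with 3 ≤ k = i - 1 ≤ n - 1. -/
def OmegaStar (n : ℕ) (hn : 3 ≤ n) : Set (Equiv.Perm (Fin n)) :=
  {perm12 n hn, perm123 n hn, perm132 n hn} ∪
    {s | ∃ k : Fin n, 3 ≤ (k : ℕ) ∧ s = perm12 n hn * Equiv.swap ⟨2, by omega⟩ k}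

/-- The godan graph EA_n: vertices are the permutations of {1,…,n}, and u,v are
adjacent iff u = v ∘ s for some s ∈ Ω* (note `(v * s) i = v (s i)` in Mathlib).
Since Ω* is closed under inverses, `fromRel` yields exactly this adjacency. -/
def godanGraph (n : ℕ) (hn : 3 ≤ n) : SimpleGraph (Equiv.Perm (Fin n)) :=
  SimpleGraph.fromRel (fun u v => ∃ s ∈ OmegaStar n hn, u = v * s)

theorem perm12_mul_self (n : ℕ) (hn : 3 ≤ n) : perm12 n hn * perm12 n hn = 1 :=
  Equiv.swap_mul_self _ _

theorem mul_perm12_mul_perm12 (n : ℕ) (hn : 3 ≤ n) (x : Equiv.Perm (Fin n)) :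
    x * perm12 n hn * perm12 n hn = x := by
  rw [mul_assoc, perm12_mul_self, mul_one]

theorem perm12_mul_perm12_mul (n : ℕ) (hn : 3 ≤ n) (x : Equiv.Perm (Fin n)) :
    perm12 n hn * (perm12 n hn * x) = x := by
  rw [← mul_assoc, perm12_mul_self, one_mul]

/-- The transposition (12) is disjoint from (3i) for i ≥ 4, so the two commute. -/
theorem swap_mul_perm12 (n : ℕ) (hn : 3 ≤ n) (k : Fin n) (hk : 3 ≤ (k : ℕ)) :
    Equiv.swap ⟨2, by omega⟩ k * perm12 n hn = perm12 n hn * Equiv.swap ⟨2, by omega⟩ k := by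
  rw [perm12, Equiv.mul_swap_eq_swap_mul, Equiv.swap_apply_of_ne_of_ne,
    Equiv.swap_apply_of_ne_of_ne] <;>
  · simp only [ne_eq, Fin.ext_iff]
    omega

/-- Ω* is stable under conjugation by (12). -/
theorem conj_perm12_mem_OmegaStar (n : ℕ) (hn : 3 ≤ n) {s : Equiv.Perm (Fin n)}
    (hs : s ∈ OmegaStar n hn) : perm12 n hn * s * perm12 n hn ∈ OmegaStar n hn := by
  rcases hs with (rfl | rfl | rfl) | ⟨k, hk, rfl⟩
  · rw [mul_perm12_mul_perm12]
    exact Or.inl (Or.inl rfl)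
  · refine Or.inl (Or.inr (Or.inr ?_))
    change perm12 n hn * (_ * perm12 n hn) * perm12 n hn = perm12 n hn * _
    rw [mul_assoc, mul_perm12_mul_perm12]
  · refine Or.inl (Or.inr (Or.inl ?_))
    change perm12 n hn * (perm12 n hn * _) * perm12 n hn = _ * perm12 n hn
    rw [perm12_mul_perm12_mul]
  · refine Or.inr ⟨k, hk, ?_⟩
    rw [perm12_mul_perm12_mul, swap_mul_perm12 n hn k hk]

theorem godanGraph_adj_mul_perm12 (n : ℕ) (hn : 3 ≤ n) {x b : Equiv.Perm (Fin n)}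
    (h : (godanGraph n hn).Adj x b) :
    (godanGraph n hn).Adj (x * perm12 n hn) (b * perm12 n hn) := by
  rw [godanGraph, SimpleGraph.fromRel_adj] at h ⊢
  refine ⟨fun e => h.1 (mul_right_cancel e), h.2.imp ?_ ?_⟩ <;>
  · rintro ⟨s, hs, rfl⟩
    refine ⟨_, conj_perm12_mem_OmegaStar n hn hs, ?_⟩
    simp only [mul_assoc, perm12_mul_perm12_mul]

/-- Right multiplication by (12) is an automorphism of the godan graph. -/
theorem godanGraph_adj_mul_perm12_iff (n : ℕ) (hn : 3 ≤ n) (x b : Equiv.Perm (Fin n)) :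
    (godanGraph n hn).Adj x b ↔
      (godanGraph n hn).Adj (x * perm12 n hn) (b * perm12 n hn) := by
  refine ⟨godanGraph_adj_mul_perm12 n hn, fun h => ?_⟩
  simpa only [mul_perm12_mul_perm12] using godanGraph_adj_mul_perm12 n hn h

/-- Let n ≥ 3 and let x, b ∈ S_n have the same parity. Then b is adjacent to x in
EA_n iff b∘(12) is adjacent to x∘(12); consequently the neighbours of x̃ = x∘(12)
of the same parity as x̃ are exactly the b∘(12) for b a neighbour of x of the same
parity as x. -/
theorem parity_neighbour_adj (n : ℕ) (hn : 3 ≤ n) (x b : Equiv.Perm (Fin n))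
    (hpar : Equiv.Perm.sign b = Equiv.Perm.sign x) :
    ((godanGraph n hn).Adj x b ↔
      (godanGraph n hn).Adj (x * perm12 n hn) (b * perm12 n hn)) ∧
    (fun c => c * perm12 n hn) ''
        {c | (godanGraph n hn).Adj x c ∧ Equiv.Perm.sign c = Equiv.Perm.sign x} =
      {c | (godanGraph n hn).Adj (x * perm12 n hn) c ∧
        Equiv.Perm.sign c = Equiv.Perm.sign (x * perm12 n hn)} := by
  refine ⟨godanGraph_adj_mul_perm12_iff n hn x b, Set.ext fun c => ⟨?_, ?_⟩⟩
  · rintro ⟨d, ⟨hd, hs⟩, rfl⟩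
    exact ⟨godanGraph_adj_mul_perm12 n hn hd, by simp only [Equiv.Perm.sign_mul, hs]⟩
  · rintro ⟨hc, hs⟩
    refine ⟨c * perm12 n hn, ⟨?_, ?_⟩, mul_perm12_mul_perm12 n hn c⟩
    · rwa [godanGraph_adj_mul_perm12_iff, mul_perm12_mul_perm12]
    · rw [Equiv.Perm.sign_mul, hs, ← Equiv.Perm.sign_mul, mul_perm12_mul_perm12]

end Godan
end

section
/- Let n ≥ 4, let i ∈ {1,…,n}, and let x be a vertex of the cluster EA_n^{n:i} (i.e., x(n) = i). Then x has exactly n − 1 neighbours inside EA_n^{n:i}, and the map sending each such neighbour y to (y∘(12)(3n))(n), the index of the cluster containing the out neighbour y' = y∘(12)(3n), is a bijection from the set of neighbours of x inside EA_n^{n:i} onto {1,…,n} \ {i}. -/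
namespace Godan

/-- The position of the n-th (last) symbol, as an index of `Fin n`. -/
def lastPos (n : ℕ) (hn : 3 ≤ n) : Fin n := ⟨n - 1, by omega⟩

/-- The permutation (12)(3n), giving the out neighbour x' = x ∘ (12)(3n). -/
def outPerm (n : ℕ) (hn : 4 ≤ n) : Equiv.Perm (Fin n) :=
  perm12 n (by omega) * Equiv.swap ⟨2, by omega⟩ ⟨n - 1, by omega⟩

theorem perm12_apply_of_two_le {n : ℕ} (hn : 3 ≤ n) {k : Fin n} (hk : 2 ≤ (k : ℕ)) :
    perm12 n hn k = k :=
  Equiv.swap_apply_of_ne_of_ne (by simp only [ne_eq, Fin.ext_iff]; omega)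
    (by simp only [ne_eq, Fin.ext_iff]; omega)

theorem perm123_apply_two {n : ℕ} (hn : 3 ≤ n) :
    perm123 n hn ⟨2, by omega⟩ = ⟨0, by omega⟩ := by
  simp [perm123, Equiv.swap_apply_def]

theorem perm132_apply_two {n : ℕ} (hn : 3 ≤ n) :
    perm132 n hn ⟨2, by omega⟩ = ⟨1, by omega⟩ := by
  simp [perm132]

theorem perm12_mul_swap_apply_two {n : ℕ} (hn : 3 ≤ n) {k : Fin n} (hk : 3 ≤ (k : ℕ)) :
    (perm12 n hn * Equiv.swap ⟨2, by omega⟩ k) ⟨2, by omega⟩ = k := by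
  rw [Equiv.Perm.mul_apply, Equiv.swap_apply_left, perm12_apply_of_two_le hn (by omega)]

theorem perm12_mul_swap_mul_self {n : ℕ} (hn : 3 ≤ n) {k : Fin n} (hk : 3 ≤ (k : ℕ)) :
    (perm12 n hn * Equiv.swap ⟨2, by omega⟩ k) * (perm12 n hn * Equiv.swap ⟨2, by omega⟩ k) =
      1 := by
  have hc : Equiv.swap ⟨2, by omega⟩ k * perm12 n hn =
      perm12 n hn * Equiv.swap ⟨2, by omega⟩ k := by
    rw [Equiv.mul_swap_eq_swap_mul, perm12_apply_of_two_le hn le_rfl,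
      perm12_apply_of_two_le hn (by omega)]
  rw [mul_assoc, ← mul_assoc (Equiv.swap _ _), hc, mul_assoc, Equiv.swap_mul_self, mul_one, perm12,
    Equiv.swap_mul_self]

theorem inv_mem_OmegaStar {n : ℕ} {hn : 3 ≤ n} {s : Equiv.Perm (Fin n)}
    (hs : s ∈ OmegaStar n hn) : s⁻¹ ∈ OmegaStar n hn := by
  rcases hs with (rfl | rfl | rfl) | ⟨k, hk, rfl⟩
  · exact Or.inl (Or.inl (by simp [perm12]))
  · exact Or.inl (Or.inr (Or.inr (by simp [perm123, perm132])))
  · exact Or.inl (Or.inr (Or.inl (by simp [perm123, perm132])))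
  · exact Or.inr ⟨k, hk, inv_eq_of_mul_eq_one_left (perm12_mul_swap_mul_self hn hk)⟩

theorem ne_one_of_mem_OmegaStar {n : ℕ} {hn : 3 ≤ n} {s : Equiv.Perm (Fin n)}
    (hs : s ∈ OmegaStar n hn) : s ≠ 1 := by
  rintro rfl
  rcases hs with (h | h | h) | ⟨k, hk, h⟩
  · simpa [perm12, Fin.ext_iff] using DFunLike.congr_fun h ⟨0, by omega⟩
  · simpa [perm123_apply_two, Fin.ext_iff] using DFunLike.congr_fun h ⟨2, by omega⟩
  · simpa [perm132_apply_two, Fin.ext_iff] using DFunLike.congr_fun h ⟨2, by omega⟩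
  · have := DFunLike.congr_fun h ⟨2, by omega⟩
    rw [perm12_mul_swap_apply_two hn hk, Equiv.Perm.one_apply, Fin.ext_iff] at this
    dsimp only at this
    omega

theorem godanGraph_adj_iff {n : ℕ} {hn : 3 ≤ n} {x y : Equiv.Perm (Fin n)} :
    (godanGraph n hn).Adj x y ↔ ∃ s ∈ OmegaStar n hn, y = x * s := by
  rw [godanGraph, SimpleGraph.fromRel_adj]
  constructor
  · rintro ⟨-, ⟨s, hs, rfl⟩ | h⟩
    · exact ⟨s⁻¹, inv_mem_OmegaStar hs, by simp⟩
    · exact h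
  · rintro ⟨s, hs, rfl⟩
    exact ⟨by simpa using (ne_one_of_mem_OmegaStar hs), Or.inr ⟨s, hs, rfl⟩⟩

/-- An element of `OmegaStar` is determined by the image of the third position. -/
theorem injOn_apply_two_OmegaStar {n : ℕ} (hn : 3 ≤ n) :
    Set.InjOn (fun s : Equiv.Perm (Fin n) => s ⟨2, by omega⟩) (OmegaStar n hn) := by
  have h12 : perm12 n hn ⟨2, by omega⟩ = ⟨2, by omega⟩ := perm12_apply_of_two_le hn le_rfl
  rintro s ((rfl | rfl | rfl) | ⟨k, hk, rfl⟩) t ((rfl | rfl | rfl) | ⟨l, hl, rfl⟩) h <;>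
    simp only [perm123_apply_two, perm132_apply_two, perm12_mul_swap_apply_two hn, *,
      Fin.ext_iff] at h <;>
    first
    | rfl
    | omega
    | rw [Fin.ext h]

theorem exists_mem_OmegaStar_apply_two {n : ℕ} (hn : 4 ≤ n) {p : Fin n}
    (hp : p ≠ lastPos n (by omega)) :
    ∃ s ∈ OmegaStar n (by omega), s ⟨2, by omega⟩ = p ∧
      s (lastPos n (by omega)) = lastPos n (by omega) := by
  obtain ⟨p, hpn⟩ := p
  have hlast : perm12 n (by omega) (lastPos n (by omega)) = lastPos n (by omega) :=
    perm12_apply_of_two_le _ (by simp only [lastPos]; omega)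
  have h0 : lastPos n (by omega) ≠ ⟨0, by omega⟩ := by simp [lastPos]; omega
  have h1 : lastPos n (by omega) ≠ ⟨1, by omega⟩ := by simp [lastPos]; omega
  have h2 : lastPos n (by omega) ≠ ⟨2, by omega⟩ := by simp [lastPos]; omega
  match p, hpn, hp with
  | 0, _, _ =>
    refine ⟨_, Or.inl (Or.inr (Or.inl rfl)), perm123_apply_two _, ?_⟩
    simp [perm123, Equiv.swap_apply_of_ne_of_ne, h0, h1, h2]
  | 1, _, _ =>
    refine ⟨_, Or.inl (Or.inr (Or.inr rfl)), perm132_apply_two _, ?_⟩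
    simp [perm132, Equiv.swap_apply_of_ne_of_ne, h0, h1, h2]
  | 2, _, _ =>
    exact ⟨_, Or.inl (Or.inl rfl), perm12_apply_of_two_le _ le_rfl, hlast⟩
  | p + 3, hpn, hp =>
    refine ⟨_, Or.inr ⟨⟨p + 3, hpn⟩, by simp, rfl⟩, perm12_mul_swap_apply_two _ (by simp), ?_⟩
    rw [Equiv.Perm.mul_apply, Equiv.swap_apply_of_ne_of_ne h2 hp.symm, hlast]

theorem outPerm_apply_lastPos {n : ℕ} (hn : 4 ≤ n) :
    outPerm n hn (lastPos n (by omega)) = ⟨2, by omega⟩ := by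
  rw [outPerm, lastPos, Equiv.Perm.mul_apply, Equiv.swap_apply_right,
    perm12_apply_of_two_le _ le_rfl]

/-- Let n ≥ 4 and let x be a vertex of the cluster EA_n^{n:i} (symbols 0-based).
Then x has exactly n − 1 neighbours inside the cluster, and sending each such
neighbour y to the cluster index of its out neighbour y' = y∘(12)(3n) is a
bijection onto the set of cluster indices other than i. -/
theorem in_cluster_neighbours (n : ℕ) (hn : 4 ≤ n) (i : Fin n)
    (x : Equiv.Perm (Fin n)) (hx : x (lastPos n (by omega)) = i) :
    Set.ncard {y | (godanGraph n (by omega)).Adj x y ∧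
        y (lastPos n (by omega)) = i} = n - 1 ∧
    Set.BijOn (fun y => (y * outPerm n hn) (lastPos n (by omega)))
      {y | (godanGraph n (by omega)).Adj x y ∧ y (lastPos n (by omega)) = i}
      {j : Fin n | j ≠ i} := by
  suffices h : Set.BijOn (fun y => (y * outPerm n hn) (lastPos n (by omega)))
      {y | (godanGraph n (by omega)).Adj x y ∧ y (lastPos n (by omega)) = i}
      {j : Fin n | j ≠ i} by
    refine ⟨?_, h⟩
    rw [← h.injOn.ncard_image, h.image_eq, ← Set.compl_singleton_eq, Set.ncard_compl]
    simp
  simp only [Equiv.Perm.mul_apply, outPerm_apply_lastPos, godanGraph_adj_iff]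
  subst hx
  refine ⟨?_, ?_, ?_⟩
  · rintro y ⟨-, hy⟩ h
    have := congrArg Fin.val (y.injective (h.trans hy.symm))
    simp only [lastPos] at this
    omega
  · rintro _ ⟨⟨s, hs, rfl⟩, -⟩ _ ⟨⟨t, ht, rfl⟩, -⟩ h
    rw [injOn_apply_two_OmegaStar (by omega) hs ht (x.injective h)]
  · intro j hj
    obtain ⟨s, hs, hs2, hsl⟩ := exists_mem_OmegaStar_apply_two hn (p := x⁻¹ j)
      (fun h => hj (by simp [← h]))
    exact ⟨x * s, ⟨⟨s, hs, rfl⟩, by simp [hsl]⟩, by simp [hs2]⟩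

end Godan
end
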